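/- Let F be a strongly irreducible minimally unsatisfiable CNF formula with more than 2 clauses, and let P be a resolution refutation of F in which two axioms C, D ∈ F are resolved together. Then at least one of C, D is used as a premise of at least one other resolution step in P. -/

import Mathlib

/-- A literal: a variable (natural number) with a polarity. -/
abbrev Lit : Type := ℕ × Bool

/-- Negation of a literal. -/
def Lit.neg (ℓ : Lit) : Lit := (ℓ.1, !ℓ.2)

/-- A clause: a finite set of literals. -/
abbrev Clause : Type := Finset Lit

/-- A clause is non-tautological: it contains no literal together with its negation. -/
def Clause.NonTaut (C : Clause) : Prop := ∀ ℓ ∈ C, Lit.neg ℓ ∉ C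

/-- A CNF formula: a finite set of clauses. -/
abbrev CNF : Type := Finset Clause

/-- A CNF formula is well-formed if all of its clauses are non-tautological. -/
def CNF.WellFormed (F : CNF) : Prop := ∀ C ∈ F, C.NonTaut

/-- A (total) assignment `τ` satisfies a literal. -/
def SatLit (τ : ℕ → Bool) (ℓ : Lit) : Prop := τ ℓ.1 = ℓ.2

/-- An assignment satisfies a clause if it satisfies some literal of it. -/
def SatClause (τ : ℕ → Bool) (C : Clause) : Prop := ∃ ℓ ∈ C, SatLit τ ℓ

/-- An assignment satisfies a CNF formula if it satisfies all of its clauses. -/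
def SatCNF (τ : ℕ → Bool) (F : CNF) : Prop := ∀ C ∈ F, SatClause τ C

/-- A CNF formula is unsatisfiable if no assignment satisfies it. -/
def Unsat (F : CNF) : Prop := ¬ ∃ τ : ℕ → Bool, SatCNF τ F

/-- `F` entails `G`: every model of `F` is a model of `G`. -/
def Entails (F G : CNF) : Prop := ∀ τ : ℕ → Bool, SatCNF τ F → SatCNF τ G

/-- Logical equivalence of CNF formulas. -/
def Equivalent (F G : CNF) : Prop := Entails F G ∧ Entails G F

/-- Two clauses clash: one contains a literal whose negation is in the other. -/
def Clash (C D : Clause) : Prop := ∃ ℓ ∈ C, Lit.neg ℓ ∈ D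

/-- A formula is hitting if every pair of distinct clauses clashes. -/
def Hitting (F : CNF) : Prop := ∀ C ∈ F, ∀ D ∈ F, C ≠ D → Clash C D

/-- The set of variables occurring in a CNF formula. -/
def cnfVars (F : CNF) : Finset ℕ := F.sup fun C => C.image Prod.fst

/-- `D` is the resolvent of `C₁` and `C₂` (on the unique clashing literal `ℓ`). -/
def Resolvent (C₁ C₂ D : Clause) : Prop :=
  ∃ ℓ : Lit, C₁ ∩ C₂.image Lit.neg = {ℓ} ∧ D = (C₁ ∪ C₂) \ {ℓ, Lit.neg ℓ}

/-- `L` is a resolution refutation of `F`: every clause of the sequence is an axiom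
(clause of `F`) or a resolvent of two earlier clauses, and the last clause is empty. -/
def IsRefutation (F : CNF) (L : List Clause) : Prop :=
  L ≠ [] ∧ L.getLast? = some (∅ : Clause) ∧
    ∀ i < L.length, L.getD i ∅ ∈ F ∨
      ∃ j k, j < i ∧ k < i ∧ Resolvent (L.getD j ∅) (L.getD k ∅) (L.getD i ∅)

/-- Resolution hardness: the minimum length of a resolution refutation. -/
noncomputable def hardness (F : CNF) : ℕ :=
  sInf {n | ∃ L : List Clause, IsRefutation F L ∧ L.length = n}

/-- The restriction `F[¬C]`: the result of setting all literals of `C` to 0 in `F`. -/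
def restrictByNegC (F : CNF) (C : Clause) : CNF :=
  (F.filter fun D => ∀ ℓ ∈ C, Lit.neg ℓ ∉ D).image fun D => D \ C

/-- `C` is a clause interpolant of `(F, H)`: `F ⊨ C` and `{C} ∪ H` is unsatisfiable. -/
def ClauseInterpolant (C : Clause) (F H : CNF) : Prop :=
  C.NonTaut ∧ Entails F {C} ∧ Unsat (insert C H)

/-- `F` is a factor of `G`: a subset of `G` logically equivalent to a single clause. -/
def IsFactor (F G : CNF) : Prop :=
  F ⊆ G ∧ ∃ C : Clause, C.NonTaut ∧ Equivalent F {C}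

/-- `F` is a pseudo-factor of `G`: `(F, G \ F)` has a clause interpolant. -/
def IsPseudoFactor (F G : CNF) : Prop :=
  F ⊆ G ∧ ∃ C : Clause, ClauseInterpolant C F (G \ F)

/-- `G` is irreducible: every factor has size 1 or `|G|`. -/
def CNF.Irreducible (G : CNF) : Prop :=
  ∀ F : CNF, IsFactor F G → F.card = 1 ∨ F.card = G.card

/-- `G` is strongly irreducible: every pseudo-factor has size 1 or `|G|`. -/
def StronglyIrreducible (G : CNF) : Prop :=
  ∀ F : CNF, IsPseudoFactor F G → F.card = 1 ∨ F.card = G.card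

/-- `F` is minimally unsatisfiable: unsatisfiable, but every proper subset is satisfiable. -/
def MinimallyUnsat (F : CNF) : Prop :=
  Unsat F ∧ ∀ G : CNF, G ⊂ F → ∃ τ : ℕ → Bool, SatCNF τ G

/-- A resolution refutation of `F` with a fixed history: a sequence of clauses ending
in the empty clause, where each clause is an axiom (history `none`) or the resolvent
of the two earlier clauses recorded in its history. -/
structure Refutation (F : CNF) where
  seq : List Clause
  hist : ℕ → Option (ℕ × ℕ)
  ne : seq ≠ []
  lastEmpty : seq.getLast? = some (∅ : Clause)
  valid : ∀ i < seq.length,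
    (hist i = none ∧ seq.getD i ∅ ∈ F) ∨
      ∃ j k, hist i = some (j, k) ∧ j < i ∧ k < i ∧
        Resolvent (seq.getD j ∅) (seq.getD k ∅) (seq.getD i ∅)

/-- The clause at position `j` is used as a premise of the resolution step at
position `i`. -/
def Refutation.UsesAt {F : CNF} (P : Refutation F) (i j : ℕ) : Prop :=
  i < P.seq.length ∧ ∃ k, P.hist i = some (j, k) ∨ P.hist i = some (k, j)

theorem Lit.neg_neg (ℓ : Lit) : Lit.neg (Lit.neg ℓ) = ℓ := by
  simp [Lit.neg]

theorem Lit.mem_image_neg {ℓ : Lit} {D : Clause} :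
    ℓ ∈ D.image Lit.neg ↔ Lit.neg ℓ ∈ D := by
  rw [Finset.mem_image]
  constructor
  · rintro ⟨m, hm, rfl⟩
    rwa [Lit.neg_neg]
  · exact fun h => ⟨_, h, Lit.neg_neg ℓ⟩

theorem SatLit.not_neg {τ : ℕ → Bool} {ℓ : Lit} (h : SatLit τ ℓ) : ¬ SatLit τ (Lit.neg ℓ) := by
  simp only [SatLit, Lit.neg] at h ⊢
  simp [h]

theorem Resolvent.exists_clash {C D R : Clause} (h : Resolvent C D R) :
    ∃ ℓ ∈ C, Lit.neg ℓ ∈ D ∧ (∀ m ∈ C, Lit.neg m ∈ D → m = ℓ) ∧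
      R = (C ∪ D) \ {ℓ, Lit.neg ℓ} := by
  obtain ⟨ℓ, hℓ, hR⟩ := h
  have key : ∀ m, (m ∈ C ∧ Lit.neg m ∈ D) ↔ m = ℓ := fun m => by
    rw [← Lit.mem_image_neg, ← Finset.mem_inter, hℓ, Finset.mem_singleton]
  obtain ⟨hC, hD⟩ := (key ℓ).2 rfl
  exact ⟨ℓ, hC, hD, fun m hm hm' => (key m).1 ⟨hm, hm'⟩, hR⟩

theorem Resolvent.nonTaut {C D R : Clause} (h : Resolvent C D R) (hC : C.NonTaut)
    (hD : D.NonTaut) : R.NonTaut := by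
  obtain ⟨ℓ, -, -, huniq, rfl⟩ := h.exists_clash
  intro x hx hnx
  simp only [Finset.mem_sdiff, Finset.mem_union, Finset.mem_insert, Finset.mem_singleton,
    not_or] at hx hnx
  obtain ⟨hxC | hxD, hx₁, -⟩ := hx <;> obtain ⟨hnC | hnD, hn₁, -⟩ := hnx
  · exact hC x hxC hnC
  · exact hx₁ (huniq x hxC hnD)
  · exact hn₁ (huniq _ hnC (by rwa [Lit.neg_neg]))
  · exact hD x hxD hnD

/-- Soundness of the resolution rule for non-tautological premises. -/
theorem Resolvent.satClause {C D R : Clause} (h : Resolvent C D R) (hC : C.NonTaut)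
    (hD : D.NonTaut) {τ : ℕ → Bool} (hτC : SatClause τ C) (hτD : SatClause τ D) :
    SatClause τ R := by
  obtain ⟨ℓ, hℓC, hℓD, -, rfl⟩ := h.exists_clash
  by_cases hℓ : SatLit τ ℓ
  · obtain ⟨d, hd, hτd⟩ := hτD
    refine ⟨d, ?_, hτd⟩
    simp only [Finset.mem_sdiff, Finset.mem_union, Finset.mem_insert, Finset.mem_singleton,
      not_or]
    refine ⟨Or.inr hd, ?_, ?_⟩
    · rintro rfl
      exact hD d hd hℓD
    · rintro rfl
      exact hℓ.not_neg hτd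
  · obtain ⟨c, hc, hτc⟩ := hτC
    refine ⟨c, ?_, hτc⟩
    simp only [Finset.mem_sdiff, Finset.mem_union, Finset.mem_insert, Finset.mem_singleton,
      not_or]
    refine ⟨Or.inl hc, ?_, ?_⟩
    · rintro rfl
      exact hℓ hτc
    · rintro rfl
      exact hC ℓ hℓC hc

theorem Resolvent.ne {C D R : Clause} (h : Resolvent C D R) (hC : C.NonTaut) : C ≠ D := by
  obtain ⟨ℓ, hℓC, hℓD, -, -⟩ := h.exists_clash
  rintro rfl
  exact hC ℓ hℓC hℓD

/-- A resolvent of two clauses is a clause interpolant of the pair they form whenever it refutes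
the rest of the formula. -/
theorem Resolvent.isPseudoFactor {F : CNF} {C D R : Clause} (h : Resolvent C D R)
    (hCF : C ∈ F) (hDF : D ∈ F) (hC : C.NonTaut) (hD : D.NonTaut)
    (hR : Unsat (insert R (F \ {C, D}))) : IsPseudoFactor {C, D} F := by
  refine ⟨by simp [Finset.insert_subset_iff, hCF, hDF], R, h.nonTaut hC hD, ?_, hR⟩
  intro τ hτ E hE
  rw [Finset.mem_singleton] at hE
  subst hE
  exact h.satClause hC hD (hτ C (by simp)) (hτ D (by simp))

theorem Refutation.nonTaut {F : CNF} (hF : F.WellFormed) (P : Refutation F) (p : ℕ)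
    (hp : p < P.seq.length) : (P.seq.getD p ∅).NonTaut := by
  induction p using Nat.strong_induction_on with
  | _ p ih =>
    obtain ⟨-, hpF⟩ | ⟨a, b, -, ha, hb, hres⟩ := P.valid p hp
    · exact hF _ hpF
    · exact hres.nonTaut (ih a ha (ha.trans hp)) (ih b hb (hb.trans hp))

theorem Refutation.exists_eq_empty {F : CNF} (P : Refutation F) :
    ∃ p < P.seq.length, P.seq.getD p ∅ = ∅ := by
  have hpos := List.length_pos_iff.2 P.ne
  refine ⟨P.seq.length - 1, by omega, ?_⟩
  rw [List.getD_eq_getElem?_getD, ← List.getLast?_eq_getElem?, P.lastEmpty, Option.getD_some]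

/-- If outside step `i` no clause of `G` is ever used as a premise, then the clauses of `P`
not in `G` follow from `F \ G` and the clause derived at step `i`. -/
theorem Refutation.satClause_of_not_usesAt {F : CNF} (hF : F.WellFormed) (P : Refutation F)
    (G : CNF) (i : ℕ) (hG : ∀ i' j', i' ≠ i → P.UsesAt i' j' → P.seq.getD j' ∅ ∉ G)
    {τ : ℕ → Bool} (hτ : SatCNF τ (insert (P.seq.getD i ∅) (F \ G))) (p : ℕ)
    (hp : p < P.seq.length) (hpG : P.seq.getD p ∅ ∉ G) : SatClause τ (P.seq.getD p ∅) := by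
  induction p using Nat.strong_induction_on with
  | _ p ih =>
    by_cases hpi : p = i
    · subst hpi
      exact hτ _ (Finset.mem_insert_self _ _)
    obtain ⟨-, hpF⟩ | ⟨a, b, hab, ha, hb, hres⟩ := P.valid p hp
    · exact hτ _ (Finset.mem_insert_of_mem (Finset.mem_sdiff.2 ⟨hpF, hpG⟩))
    · have hap := ha.trans hp
      have hbp := hb.trans hp
      exact hres.satClause (P.nonTaut hF a hap) (P.nonTaut hF b hbp)
        (ih a ha hap (hG p a hpi ⟨hp, b, Or.inl hab⟩))
        (ih b hb hbp (hG p b hpi ⟨hp, a, Or.inr hab⟩))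


/-- if `F` is a strongly irreducible minimally unsatisfiable formula with
more than 2 clauses and two axioms `C, D ∈ F` are resolved together at some step of a
refutation `P` of `F`, then at least one of the clauses `C`, `D` is used as a premise
of at least one other resolution step of `P`. -/
theorem axiom_reuse (F : CNF) (hwf : F.WellFormed) (hmu : MinimallyUnsat F)
    (hsi : StronglyIrreducible F) (hm : 2 < F.card)
    (P : Refutation F) (C D : Clause) (hC : C ∈ F) (hD : D ∈ F)
    (i j k : ℕ) (hi : i < P.seq.length)
    (hstep : P.hist i = some (j, k))
    (haxj : P.hist j = none) (haxk : P.hist k = none)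
    (hjC : P.seq.getD j ∅ = C) (hkD : P.seq.getD k ∅ = D) :
    ∃ i' j', i' ≠ i ∧ P.UsesAt i' j' ∧
      (P.seq.getD j' ∅ = C ∨ P.seq.getD j' ∅ = D) := by
  by_contra! hcon
  obtain ⟨hnone, -⟩ | ⟨a, b, hab, -, -, hres⟩ := P.valid i hi
  · simp [hstep] at hnone
  obtain ⟨rfl, rfl⟩ : j = a ∧ k = b := by simpa [hstep] using hab
  rw [hjC, hkD] at hres
  have hunsat : Unsat (insert (P.seq.getD i ∅) (F \ {C, D})) := by
    rintro ⟨τ, hτ⟩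
    obtain ⟨p, hp, hempty⟩ := P.exists_eq_empty
    obtain ⟨ℓ, hℓC, hℓD, -, -⟩ := hres.exists_clash
    have hsat := P.satClause_of_not_usesAt hwf {C, D} i
      (fun i' j' hne huse => by simpa using hcon i' j' hne huse) hτ p hp (by
        rw [hempty, Finset.mem_insert, Finset.mem_singleton]
        rintro (rfl | rfl)
        · simp at hℓC
        · simp at hℓD)
    rw [hempty] at hsat
    simp [SatClause] at hsat
  have hcard : ({C, D} : CNF).card = 2 := Finset.card_pair (hres.ne (hwf C hC))
  have := hsi _ (hres.isPseudoFactor hC hD (hwf C hC) (hwf D hD) hunsat)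
  omega
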